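/- (Variational representation of the rate function.) For every x ∈ (0,1), I(x) = sup_{z∈(0,1)} h_x(z) = sup_{λ>0} ( λ·x + ln(1 − (1 − e^{−λ})^{1/α}) ). -/

import Mathlib

/-- The function `h_x(z) = ln z - x ln(1-(1-z)^α)` for `z ∈ (0,1)`. -/
noncomputable def hfun (α x : ℝ) : ℝ → ℝ :=
  fun z => Real.log z - x * Real.log (1 - (1 - z) ^ α)

/-- The rate function `I(x) = h_x(z(x))`, where `zf` is the saddle-point map. -/
noncomputable def Ifun (α : ℝ) (zf : ℝ → ℝ) : ℝ → ℝ :=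
  fun x => hfun α x (zf x)

open Set

/-- The numerator of `hfun α x`'s derivative at `1 - w`, up to a positive factor. -/
noncomputable def derivNumerator (α x w : ℝ) : ℝ :=
  w ^ (1 - α) - w - x * α * (1 - w)

lemma derivNumerator_one (α x : ℝ) : derivNumerator α x 1 = 0 := by
  simp [derivNumerator]

lemma concaveOn_derivNumerator {α : ℝ} (hα : α ∈ Ioo (0 : ℝ) 1) (x : ℝ) :
    ConcaveOn ℝ (Ici 0) (derivNumerator α x) := by
  have h := Real.concaveOn_rpow (p := 1 - α) (by linarith [hα.2]) (by linarith [hα.1])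
  refine ⟨h.1, fun u hu v hv a b ha hb hab => ?_⟩
  have h' := h.2 hu hv ha hb hab
  simp only [smul_eq_mul, derivNumerator] at h' ⊢
  obtain rfl : b = 1 - a := by linarith
  linarith

lemma derivNumerator_nonneg {α x w₀ w : ℝ} (hα : α ∈ Ioo (0 : ℝ) 1) (h₀ : 0 ≤ w₀)
    (hzero : derivNumerator α x w₀ = 0) (hw : w₀ < w) (hw1 : w < 1) :
    0 ≤ derivNumerator α x w := by
  have h := (concaveOn_derivNumerator hα x).slope_anti_adjacent h₀
    (mem_Ici.2 zero_le_one) hw hw1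
  rw [hzero, derivNumerator_one] at h
  by_contra! hneg
  have h₁ : 0 < (0 - derivNumerator α x w) / (1 - w) := div_pos (by linarith) (by linarith)
  have h₂ : (derivNumerator α x w - 0) / (w - w₀) < 0 :=
    div_neg_of_neg_of_pos (by linarith) (by linarith)
  linarith

lemma derivNumerator_nonpos {α x w₀ w : ℝ} (hα : α ∈ Ioo (0 : ℝ) 1) (h : 0 ≤ w)
    (hzero : derivNumerator α x w₀ = 0) (hw : w < w₀) (hw1 : w₀ < 1) :
    derivNumerator α x w ≤ 0 := by
  have h := (concaveOn_derivNumerator hα x).slope_anti_adjacent h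
    (mem_Ici.2 zero_le_one) hw hw1
  rw [hzero, derivNumerator_one, sub_self, zero_div, zero_sub] at h
  by_contra! hpos
  have : -derivNumerator α x w / (w₀ - w) < 0 :=
    div_neg_of_neg_of_pos (by linarith) (by linarith)
  linarith

lemma one_sub_one_sub_rpow_mem_Ioo {p z : ℝ} (hp : 0 < p) (hz : z ∈ Ioo (0 : ℝ) 1) :
    1 - (1 - z) ^ p ∈ Ioo (0 : ℝ) 1 := by
  have h₁ := Real.rpow_lt_one (x := 1 - z) (by linarith [hz.2]) (by linarith [hz.1]) hp
  have h₂ := Real.rpow_pos_of_pos (x := 1 - z) (by linarith [hz.2]) p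
  constructor <;> linarith

lemma hasDerivAt_hfun {α z : ℝ} (hα : 0 < α) (x : ℝ) (hz : z ∈ Ioo (0 : ℝ) 1) :
    HasDerivAt (hfun α x)
      (derivNumerator α x (1 - z) * ((1 - z) ^ (α - 1) / (z * (1 - (1 - z) ^ α)))) z := by
  have hw : 0 < 1 - z := by linarith [hz.2]
  have hpos := (one_sub_one_sub_rpow_mem_Ioo hα hz).1
  have h₁ : HasDerivAt (fun z : ℝ => 1 - (1 - z) ^ α) (α * (1 - z) ^ (α - 1)) z := by
    refine ((((hasDerivAt_id' z).const_sub 1).rpow_const (p := α)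
      (Or.inl hw.ne')).const_sub 1).congr_deriv ?_
    ring
  have h₂ := (Real.hasDerivAt_log hz.1.ne').sub ((h₁.log hpos.ne').const_mul x)
  refine h₂.congr_deriv ?_
  have e₁ : (1 - z) ^ (1 - α) * (1 - z) ^ (α - 1) = 1 := by
    rw [← Real.rpow_add hw]; simp
  have e₂ : (1 - z) * (1 - z) ^ (α - 1) = (1 - z) ^ α := by
    rw [Real.rpow_sub_one hw.ne']; field_simp
  have hz0 := hz.1.ne'
  have hne := hpos.ne'
  have hnum : derivNumerator α x (1 - z) * (1 - z) ^ (α - 1)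
      = 1 - (1 - z) ^ α - x * α * z * (1 - z) ^ (α - 1) := by
    unfold derivNumerator
    linear_combination e₁ - e₂
  rw [← mul_div_assoc (derivNumerator α x (1 - z)), hnum]
  field_simp

lemma isMaxOn_hfun {α x z₀ : ℝ} (hα : α ∈ Ioo (0 : ℝ) 1) (hz₀ : z₀ ∈ Ioo (0 : ℝ) 1)
    (hcrit : deriv (hfun α x) z₀ = 0) : IsMaxOn (hfun α x) (Ioo 0 1) z₀ := by
  have hfactor {z : ℝ} (hz : z ∈ Ioo (0 : ℝ) 1) :
      0 < (1 - z) ^ (α - 1) / (z * (1 - (1 - z) ^ α)) :=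
    div_pos (Real.rpow_pos_of_pos (by linarith [hz.2]) _)
      (mul_pos hz.1 (one_sub_one_sub_rpow_mem_Ioo hα.1 hz).1)
  have hzero : derivNumerator α x (1 - z₀) = 0 := by
    rw [(hasDerivAt_hfun hα.1 x hz₀).deriv] at hcrit
    exact (mul_eq_zero.mp hcrit).resolve_right (hfactor hz₀).ne'
  intro z hz
  rcases le_total z z₀ with hle | hle
  · have hsub : Icc z z₀ ⊆ Ioo 0 1 := Icc_subset_Ioo hz.1 hz₀.2
    refine monotoneOn_of_deriv_nonneg (convex_Icc z z₀)
      (fun y hy => (hasDerivAt_hfun hα.1 x (hsub hy)).continuousAt.continuousWithinAt)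
      (fun y hy => (hasDerivAt_hfun hα.1 x
        (hsub (interior_subset hy))).differentiableAt.differentiableWithinAt)
      (fun y hy => ?_) (left_mem_Icc.2 hle) (right_mem_Icc.2 hle) hle
    have hy' := hsub (interior_subset hy)
    rw [interior_Icc] at hy
    rw [(hasDerivAt_hfun hα.1 x hy').deriv]
    exact mul_nonneg (derivNumerator_nonneg hα (by linarith [hz₀.2]) hzero
      (by linarith [hy.2]) (by linarith [hy'.1])) (hfactor hy').le
  · have hsub : Icc z₀ z ⊆ Ioo 0 1 := Icc_subset_Ioo hz₀.1 hz.2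
    refine antitoneOn_of_deriv_nonpos (convex_Icc z₀ z)
      (fun y hy => (hasDerivAt_hfun hα.1 x (hsub hy)).continuousAt.continuousWithinAt)
      (fun y hy => (hasDerivAt_hfun hα.1 x
        (hsub (interior_subset hy))).differentiableAt.differentiableWithinAt)
      (fun y hy => ?_) (left_mem_Icc.2 hle) (right_mem_Icc.2 hle) hle
    have hy' := hsub (interior_subset hy)
    rw [interior_Icc] at hy
    rw [(hasDerivAt_hfun hα.1 x hy').deriv]
    exact mul_nonpos_of_nonpos_of_nonneg (derivNumerator_nonpos hα (by linarith [hy'.2]) hzero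
      (by linarith [hy.1]) (by linarith [hz₀.1])) (hfactor hy').le

/-- The substitution `exp (-λ) = 1 - (1 - z) ^ α` identifies the two sets of values. -/
lemma image_exp_substitution_eq_image_hfun {α : ℝ} (hα : 0 < α) (x : ℝ) :
    (fun lam : ℝ => lam * x + Real.log (1 - (1 - Real.exp (-lam)) ^ (1 / α))) '' Ioi (0 : ℝ)
      = hfun α x '' Ioo (0 : ℝ) 1 := by
  apply Subset.antisymm
  · rintro _ ⟨lam, hlam, rfl⟩
    have hexp : Real.exp (-lam) ∈ Ioo (0 : ℝ) 1 :=
      ⟨Real.exp_pos _, Real.exp_lt_one_iff.2 (neg_lt_zero.2 hlam)⟩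
    refine ⟨_, one_sub_one_sub_rpow_mem_Ioo (one_div_pos.2 hα) hexp, ?_⟩
    simp only [hfun]
    rw [sub_sub_cancel, ← Real.rpow_mul (by linarith [hexp.2]), one_div_mul_cancel hα.ne',
      Real.rpow_one, sub_sub_cancel, Real.log_exp]
    ring
  · rintro _ ⟨z, hz, rfl⟩
    have hmem := one_sub_one_sub_rpow_mem_Ioo hα hz
    refine ⟨-Real.log (1 - (1 - z) ^ α), neg_pos.2 (Real.log_neg hmem.1 hmem.2), ?_⟩
    simp only [hfun]
    rw [neg_neg, Real.exp_log hmem.1, sub_sub_cancel, ← Real.rpow_mul (by linarith [hz.2]),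
      mul_one_div_cancel hα.ne', Real.rpow_one, sub_sub_cancel]
    ring

/-- variational representation of the rate function: for every
`x ∈ (0,1)`, `I(x) = sup_{z∈(0,1)} h_x(z) = sup_{λ>0} (λx + ln(1-(1-e^{-λ})^{1/α}))`. -/
theorem rate_function_variational (α : ℝ) (hα : α ∈ Set.Ioo (0 : ℝ) 1)
    (zf : ℝ → ℝ)
    (hzf : ∀ x ∈ Set.Ioo (0 : ℝ) 1, zf x ∈ Set.Ioo (0 : ℝ) 1 ∧
      deriv (hfun α x) (zf x) = 0) :
    ∀ x ∈ Set.Ioo (0 : ℝ) 1,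
      Ifun α zf x = sSup (hfun α x '' Set.Ioo (0 : ℝ) 1) ∧
      Ifun α zf x = sSup ((fun lam : ℝ =>
        lam * x + Real.log (1 - (1 - Real.exp (-lam)) ^ (1 / α))) ''
          Set.Ioi (0 : ℝ)) := by
  intro x hx
  obtain ⟨hz, hcrit⟩ := hzf x hx
  have hgreatest : IsGreatest (hfun α x '' Set.Ioo (0 : ℝ) 1) (Ifun α zf x) :=
    ⟨Set.mem_image_of_mem _ hz, Set.forall_mem_image.2 (isMaxOn_hfun hα hz hcrit)⟩
  rw [image_exp_substitution_eq_image_hfun hα.1]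
  exact ⟨hgreatest.csSup_eq.symm, hgreatest.csSup_eq.symm⟩
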